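/- For any hypergraph communication situation (N,v,H), the Shapley value of the uniform hyperlink game equals the Myerson value of the hyperlink agent form: Sh_l(U(H),w) = μ_l(N̄,v̄,H̄) for every l∈U(H)=N̄, where (N̄,v̄,H̄)=HAF(N,v,H) and μ(N̄,v̄,H̄)=Sh(N̄,v̄^{H̄}). -/

import Mathlib

open scoped Classical
open Finset

noncomputable section

namespace HGGame

/-! ## Generic hypergraph notions -/

variable {α : Type*}

/-- Two nodes are linked if they lie in a common hyperlink of `E`. -/
def Linked (E : Finset (Finset α)) (a b : α) : Prop :=
  ∃ e ∈ E, a ∈ e ∧ b ∈ e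

/-- The component of `i` in the subhypergraph of `(α, E)` induced by the ground set `S`
(only hyperlinks contained in `S` count). -/
def compOf (E : Finset (Finset α)) (S : Finset α) (i : α) : Finset α :=
  S.filter (fun j => Relation.ReflTransGen (Linked (E.filter (fun e => e ⊆ S))) i j)

/-- The set `S/E` of components of the subhypergraph induced by `S`. -/
def components (E : Finset (Finset α)) (S : Finset α) : Finset (Finset α) :=
  S.image (compOf E S)

/-- The hypergraph-restricted worth `v^E(S) = Σ_{T ∈ S/E} v(T)`. -/
def restrictedWorth (v : Finset α → ℝ) (E : Finset (Finset α)) (S : Finset α) : ℝ :=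
  ∑ T ∈ components E S, v T

/-! ## Shapley value -/

/-- The set `σ^i` of players preceding `i` in the ordering `σ`. -/
def preceding {M : Type*} [Fintype M] (σ : M ≃ Fin (Fintype.card M)) (i : M) : Finset M :=
  Finset.univ.filter (fun j => σ j < σ i)

/-- The marginal contribution `m^σ_i(u) = u(σ^i ∪ {i}) - u(σ^i)`. -/
def marginal {M : Type*} [Fintype M] (u : Finset M → ℝ) (σ : M ≃ Fin (Fintype.card M))
    (i : M) : ℝ :=
  u (insert i (preceding σ i)) - u (preceding σ i)

/-- The Shapley value of the TU-game `(M, u)`. -/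
def shapley {M : Type*} [Fintype M] (u : Finset M → ℝ) (i : M) : ℝ :=
  ((Fintype.card M).factorial : ℝ)⁻¹ * ∑ σ : M ≃ Fin (Fintype.card M), marginal u σ i

/-- The Harsanyi dividend `λ_T(u) = Σ_{∅ ≠ S ⊆ T} (-1)^{|T|-|S|} u(S)`. -/
def dividend {M : Type*} (u : Finset M → ℝ) (T : Finset M) : ℝ :=
  ∑ S ∈ T.powerset.filter (fun S => S ≠ ∅), (-1 : ℝ) ^ (T.card - S.card) * u S

/-! ## Hypergraph communication situations -/

variable {N : Type*} [Fintype N] [DecidableEq N]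

/-- The conference game `(H, v^N)`, a TU-game with player set `H`:
`v^N(H') = Σ_{T ∈ N/H'} v(T)`. -/
def confGame (v : Finset N → ℝ) (H : Finset (Finset N)) (F : Finset {e // e ∈ H}) : ℝ :=
  restrictedWorth v (F.image Subtype.val) Finset.univ

/-- The position value `π_i(N,v,H) = Σ_{e ∈ H_i} (1/|e|) · Sh_e(H, v^N)`. -/
def positionValue (v : Finset N → ℝ) (H : Finset (Finset N)) (i : N) : ℝ :=
  ∑ e ∈ H.attach.filter (fun e => i ∈ e.val),
    ((e.val.card : ℝ))⁻¹ * shapley (confGame v H) e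

/-! ## The uniform hyperlink game -/

/-- The type of agents `(i, e, k)` of the uniform hyperlink game. -/
abbrev UElem (N : Type*) := N × Finset N × ℕ

/-- `η(H)`: the least common multiple of the hyperlink sizes. -/
def eta (H : Finset (Finset N)) : ℕ := H.lcm Finset.card

/-- `U(H)(i,e) = {(i,e,k) : k = 1, …, η(H)/|e|}`. -/
def UHie (H : Finset (Finset N)) (i : N) (e : Finset N) : Finset (UElem N) :=
  (Finset.Icc 1 (eta H / e.card)).image fun k => (i, e, k)

/-- `U(H)(i) = ∪_{e ∈ H_i} U(H)(i,e)`. -/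
def UHi (H : Finset (Finset N)) (i : N) : Finset (UElem N) :=
  (H.filter (fun e => i ∈ e)).biUnion fun e => UHie H i e

/-- `U(H)(e) = ∪_{i ∈ e} U(H)(i,e)`. -/
def UHe (H : Finset (Finset N)) (e : Finset N) : Finset (UElem N) :=
  e.biUnion fun i => UHie H i e

/-- `U(H) = ∪_{i ∈ N} U(H)(i)`. -/
def UH (H : Finset (Finset N)) : Finset (UElem N) :=
  Finset.univ.biUnion fun i : N => UHi H i

/-- `H[S] = {e ∈ H : U(H)(e) ⊆ S}`. -/
def Hof (H : Finset (Finset N)) (S : Finset (UElem N)) : Finset (Finset N) :=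
  H.filter fun e => UHe H e ⊆ S

/-- The characteristic function `w(S) = Σ_{R ∈ N/H[S]} v(R)` of the uniform hyperlink game. -/
def uw (v : Finset N → ℝ) (H : Finset (Finset N)) (S : Finset (UElem N)) : ℝ :=
  restrictedWorth v (Hof H S) Finset.univ

/-- The uniform hyperlink game `(U(H), w)` as a TU-game with player set `U(H)`. -/
def uGame (v : Finset N → ℝ) (H : Finset (Finset N)) (F : Finset {l // l ∈ UH H}) : ℝ :=
  uw v H (F.image Subtype.val)

/-! ## The hyperlink agent form (HAF) -/

variable {N : Type*} [Fintype N] [DecidableEq N]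

/-- The hyperlink set `H̄ = {h̄ : h ∈ H} ∪ ∪_{i ∈ N} L^{N̄(i)}` of the hyperlink agent
form, where `h̄ = ∪_{i ∈ h} N̄(i,h) = U(H)(h)` and `L^{N̄(i)}` is the set of all
2-element subsets of `N̄(i) = U(H)(i)`. -/
def HAFedges (H : Finset (Finset N)) : Finset (Finset (UElem N)) :=
  (H.image fun h => UHe H h) ∪ Finset.univ.biUnion fun i : N => (UHi H i).powersetCard 2

/-- The characteristic function `v̄(K̄) = v(N(K̄))` of the hyperlink agent form, where
`N(K̄) = {i ∈ N : N̄(i) ∩ K̄ ≠ ∅}` and `v̄(∅) = 0`. -/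
def barv (v : Finset N → ℝ) (H : Finset (Finset N)) (K : Finset (UElem N)) : ℝ :=
  if K = ∅ then 0 else v (Finset.univ.filter fun i : N => (UHi H i ∩ K).Nonempty)

/-- Two nodes lie in a common hyperlink of `E` that is contained in `S`. -/
def LinkedIn (E : Finset (Finset α)) (S : Finset α) (a b : α) : Prop :=
  ∃ e ∈ E, e ⊆ S ∧ a ∈ e ∧ b ∈ e

lemma LinkedIn.symm {E : Finset (Finset α)} {S : Finset α} {a b : α} :
    LinkedIn E S a b → LinkedIn E S b a :=
  fun ⟨e, he, heS, ha, hb⟩ => ⟨e, he, heS, hb, ha⟩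

lemma mem_compOf {E : Finset (Finset α)} {S : Finset α} {i j : α} :
    j ∈ compOf E S i ↔ j ∈ S ∧ Relation.ReflTransGen (LinkedIn E S) i j := by
  have h : Linked (E.filter (fun e => e ⊆ S)) = LinkedIn E S := by
    ext a b
    simp only [Linked, LinkedIn, mem_filter, and_assoc]
  rw [compOf, mem_filter, h]

lemma mem_components {E : Finset (Finset α)} {S T : Finset α} :
    T ∈ components E S ↔ ∃ i ∈ S, compOf E S i = T := by
  simp [components]

lemma compOf_eq_of_mem {E : Finset (Finset α)} {S : Finset α} {i j : α}
    (h : j ∈ compOf E S i) : compOf E S j = compOf E S i := by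
  have hij := (mem_compOf.1 h).2
  have hji : Relation.ReflTransGen (LinkedIn E S) j i :=
    Relation.ReflTransGen.mono (fun _ _ h => LinkedIn.symm h) _ _ hij.swap
  ext k
  simp only [mem_compOf]
  exact and_congr_right fun _ => ⟨hij.trans, hji.trans⟩

lemma mem_UHie {H : Finset (Finset N)} {i : N} {e : Finset N} {x : UElem N} :
    x ∈ UHie H i e ↔ x.1 = i ∧ x.2.1 = e ∧ 1 ≤ x.2.2 ∧ x.2.2 ≤ eta H / e.card := by
  obtain ⟨a, f, k⟩ := x
  simp only [UHie, mem_image, mem_Icc, Prod.mk.injEq]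
  grind

lemma mem_UHi {H : Finset (Finset N)} {i : N} {x : UElem N} :
    x ∈ UHi H i ↔ x.1 = i ∧ x ∈ UH H := by
  simp only [UH, UHi, mem_biUnion, mem_filter, mem_UHie, mem_univ, true_and]
  grind

lemma mem_UHe {H : Finset (Finset N)} {e : Finset N} {x : UElem N} :
    x ∈ UHe H e ↔ x.1 ∈ e ∧ x.2.1 = e ∧ 1 ≤ x.2.2 ∧ x.2.2 ≤ eta H / e.card := by
  simp only [UHe, mem_biUnion, mem_UHie]
  grind

lemma mk_one_mem_UHe {H : Finset (Finset N)} (hH : ∀ e ∈ H, 1 < e.card) {e : Finset N}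
    (he : e ∈ H) {i : N} (hi : i ∈ e) : ((i, e, 1) : UElem N) ∈ UHe H e := by
  have hpos : 0 < eta H := by
    refine Nat.pos_of_ne_zero fun h0 => ?_
    obtain ⟨f, hf, hf0⟩ := Finset.lcm_eq_zero_iff.1 h0
    have := hH f hf
    omega
  have hle : e.card ≤ eta H := Nat.le_of_dvd hpos (Finset.dvd_lcm he)
  exact mem_UHe.2 ⟨hi, rfl, le_rfl, (Nat.one_le_div_iff (by have := hH e he; omega)).2 hle⟩

lemma mem_Hof {H : Finset (Finset N)} {S : Finset (UElem N)} {e : Finset N} :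
    e ∈ Hof H S ↔ e ∈ H ∧ UHe H e ⊆ S := by
  simp [Hof]

lemma mem_HAFedges {H : Finset (Finset N)} {E : Finset (UElem N)} :
    E ∈ HAFedges H ↔ (∃ h ∈ H, UHe H h = E) ∨ ∃ i, E ⊆ UHi H i ∧ E.card = 2 := by
  simp [HAFedges, mem_powersetCard]

/-- Agents of the same player in `S` are connected in the hyperlink agent form on `S`. -/
lemma reachable_of_same_player {H : Finset (Finset N)} {S : Finset (UElem N)} (hS : S ⊆ UH H)
    {x y : UElem N} (hx : x ∈ S) (hy : y ∈ S) (hxy : x.1 = y.1) :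
    Relation.ReflTransGen (LinkedIn (HAFedges H) S) x y := by
  by_cases h : x = y
  · rw [h]
  · refine .single ⟨{x, y}, mem_HAFedges.2 (.inr ⟨x.1, ?_, card_pair h⟩), ?_,
      by simp, by simp⟩
    · intro z hz
      rcases mem_insert.1 hz with rfl | hz
      · exact mem_UHi.2 ⟨rfl, hS hx⟩
      · rw [mem_singleton.1 hz]
        exact mem_UHi.2 ⟨hxy.symm, hS hy⟩
    · intro z hz
      rcases mem_insert.1 hz with rfl | hz
      · exact hx
      · rwa [mem_singleton.1 hz]

/-- Connectedness of agents in the hyperlink agent form on `S` is connectedness of their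
players in `(N, H[S])`. -/
lemma mem_compOf_HAFedges_iff {H : Finset (Finset N)} (hH : ∀ e ∈ H, 1 < e.card)
    {S : Finset (UElem N)} (hS : S ⊆ UH H) {x y : UElem N} (hx : x ∈ S) (hy : y ∈ S) :
    y ∈ compOf (HAFedges H) S x ↔ y.1 ∈ compOf (Hof H S) univ x.1 := by
  simp only [mem_compOf, hy, mem_univ, true_and]
  constructor
  · intro h
    refine h.lift' Prod.fst ?_
    rintro a b ⟨E, hE, hES, ha, hb⟩
    rcases mem_HAFedges.1 hE with ⟨e, he, rfl⟩ | ⟨i, hi, -⟩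
    · exact .single ⟨e, mem_Hof.2 ⟨he, hES⟩, subset_univ _,
        (mem_UHe.1 ha).1, (mem_UHe.1 hb).1⟩
    · change Relation.ReflTransGen _ a.1 b.1
      rw [(mem_UHi.1 (hi ha)).1, (mem_UHi.1 (hi hb)).1]
  · intro h
    generalize hj : y.1 = j at h
    induction h generalizing y with
    | refl => exact reachable_of_same_player hS hx hy hj.symm
    | tail _ hl ih =>
      obtain ⟨e, he, -, ha, hb⟩ := hl
      obtain ⟨heH, heS⟩ := mem_Hof.1 he
      have ha' := mk_one_mem_UHe hH heH ha
      have hb' := mk_one_mem_UHe hH heH hb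
      refine ((ih (heS ha') rfl).tail ⟨UHe H e, ?_, heS, ha', hb'⟩).trans
        (reachable_of_same_player hS (heS hb') hy hj.symm)
      exact mem_HAFedges.2 (.inl ⟨e, heH, rfl⟩)

/-- A player without agents in `S` is isolated in `(N, H[S])`. -/
lemma eq_or_exists_agent_of_mem_compOf {H : Finset (Finset N)} (hH : ∀ e ∈ H, 1 < e.card)
    {S : Finset (UElem N)} {i j : N} (h : j ∈ compOf (Hof H S) univ i) :
    j = i ∨ (∃ y ∈ S, y.1 = i) ∧ ∃ y ∈ S, y.1 = j := by
  have hsub : ∀ {a b}, LinkedIn (Hof H S) univ a b →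
      ∃ y ∈ S, y.1 = a := by
    rintro a b ⟨e, he, -, ha, -⟩
    obtain ⟨heH, heS⟩ := mem_Hof.1 he
    exact ⟨_, heS (mk_one_mem_UHe hH heH ha), rfl⟩
  have hr := (mem_compOf.1 h).2
  rcases hr.cases_head with rfl | ⟨c, hic, -⟩
  · exact .inl rfl
  rcases hr.cases_tail with rfl | ⟨d, -, hdj⟩
  · exact .inl rfl
  · exact .inr ⟨hsub hic, hsub hdj.symm⟩

/-- The players represented in the component of the agent `x` form the component of the player
of `x` in `(N, H[S])`. -/
lemma players_compOf {H : Finset (Finset N)} (hH : ∀ e ∈ H, 1 < e.card)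
    {S : Finset (UElem N)} (hS : S ⊆ UH H) {x : UElem N} (hx : x ∈ S) :
    (univ.filter fun i : N => (UHi H i ∩ compOf (HAFedges H) S x).Nonempty)
      = compOf (Hof H S) univ x.1 := by
  ext i
  simp only [mem_filter, mem_univ, true_and]
  constructor
  · rintro ⟨y, hy⟩
    obtain ⟨hyi, hyx⟩ := mem_inter.1 hy
    rw [← (mem_UHi.1 hyi).1]
    exact (mem_compOf_HAFedges_iff hH hS hx (mem_compOf.1 hyx).1).1 hyx
  · intro h
    obtain ⟨y, hyS, rfl⟩ : ∃ y ∈ S, y.1 = i := by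
      rcases eq_or_exists_agent_of_mem_compOf hH h with rfl | ⟨-, h'⟩
      · exact ⟨x, hx, rfl⟩
      · exact h'
    exact ⟨y, mem_inter.2 ⟨mem_UHi.2 ⟨rfl, hS hyS⟩,
      (mem_compOf_HAFedges_iff hH hS hx hyS).2 h⟩⟩

/-- The uniform hyperlink game and the hypergraph-restricted game of the hyperlink agent form
coincide. -/
lemma uw_eq_restrictedWorth_HAF (v : Finset N → ℝ) {H : Finset (Finset N)}
    (hzn : ∀ i : N, v {i} = 0) (hH : ∀ e ∈ H, 1 < e.card)
    {S : Finset (UElem N)} (hS : S ⊆ UH H) :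
    uw v H S = restrictedWorth (barv v H) (HAFedges H) S := by
  have hself : ∀ {x}, x ∈ S → x ∈ compOf (HAFedges H) S x := fun hx => mem_compOf.2 ⟨hx, .refl⟩
  have hsum : restrictedWorth (barv v H) (HAFedges H) S
      = ∑ T ∈ S.image (fun x => compOf (Hof H S) univ x.1), v T := by
    refine sum_bij
      (fun K _ => univ.filter fun i : N => (UHi H i ∩ K).Nonempty) ?_ ?_ ?_ ?_
    · intro K hK
      obtain ⟨x, hx, rfl⟩ := mem_components.1 hK
      rw [players_compOf hH hS hx]
      exact mem_image_of_mem _ hx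
    · intro K hK L hL hKL
      obtain ⟨x, hx, rfl⟩ := mem_components.1 hK
      obtain ⟨y, hy, rfl⟩ := mem_components.1 hL
      rw [players_compOf hH hS hx, players_compOf hH hS hy] at hKL
      refine compOf_eq_of_mem ((mem_compOf_HAFedges_iff hH hS hy hx).2 ?_)
      rw [← hKL]
      exact mem_compOf.2 ⟨mem_univ _, .refl⟩
    · intro T hT
      obtain ⟨x, hx, rfl⟩ := mem_image.1 hT
      exact ⟨_, mem_components.2 ⟨x, hx, rfl⟩, players_compOf hH hS hx⟩
    · intro K hK
      obtain ⟨x, hx, rfl⟩ := mem_components.1 hK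
      exact if_neg (ne_empty_of_mem (hself hx))
  rw [hsum, uw, restrictedWorth]
  symm
  refine sum_subset ?_ ?_
  · intro T hT
    obtain ⟨x, -, rfl⟩ := mem_image.1 hT
    exact mem_components.2 ⟨_, mem_univ _, rfl⟩
  · intro T hT hnT
    obtain ⟨i, -, rfl⟩ := mem_components.1 hT
    have hi : compOf (Hof H S) univ i = {i} := by
      refine eq_singleton_iff_unique_mem.2 ⟨mem_compOf.2 ⟨mem_univ _, .refl⟩, fun j hj => ?_⟩
      rcases eq_or_exists_agent_of_mem_compOf hH hj with h | ⟨⟨y, hyS, rfl⟩, -⟩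
      · exact h
      · exact absurd (mem_image_of_mem (fun x => compOf (Hof H S) univ x.1) hyS) hnT
    rw [hi, hzn]

/-- Corollary 1: the Shapley value of the uniform hyperlink game equals the Myerson
value of the hyperlink agent form, i.e. the Shapley value of the hypergraph-restricted
game `v̄^{H̄}` on the player set `N̄ = U(H)`. -/
theorem uniform_hyperlink_shapley_eq_HAF_myerson
    (v : Finset N → ℝ) (H : Finset (Finset N))
    (hN : 2 ≤ Fintype.card N)
    (hv0 : v ∅ = 0) (hzn : ∀ i : N, v {i} = 0)
    (hH : ∀ e ∈ H, 1 < e.card) :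
    ∀ l : {x // x ∈ UH H},
      shapley (uGame v H) l
        = shapley (fun F : Finset {x // x ∈ UH H} =>
            restrictedWorth (barv v H) (HAFedges H) (F.image Subtype.val)) l := by
  intro l
  congr 1
  funext F
  refine uw_eq_restrictedWorth_HAF v hzn hH fun x hx => ?_
  obtain ⟨y, -, rfl⟩ := mem_image.1 hx
  exact y.2

end HGGame
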